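/- arXiv:2510.22186 — 2 statements merged into one kernel-verified Lean document; each statement's English description precedes it below -/
import Mathlib

section
/- Let n ≥ 1 be a natural number, set D = 4n², and let A ∈ ℝ^{2×D} be the matrix whose k-th column is a_k := (cos(2πk/D), sin(2πk/D)) for k ∈ [D]. Then for all X, Y ∈ ℝ^{n×2}, (1/(√2·n)) · dist(X,Y) ≤ ‖β_A(X) − β_A(Y)‖_F ≤ √2·n · dist(X,Y); in particular, the bi-Lipschitz distortion of β_A on ℝ^{n×2}/S_n is at most 2n². -/
open Matrix MeasureTheory

/-- `sortVec v` rearranges the entries of `v` in non-decreasing order. -/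
noncomputable def sortVec {n : ℕ} (v : Fin n → ℝ) : Fin n → ℝ := v ∘ Tuple.sort v

/-- The sorting-based embedding `β_A`: the `k`-th column of `β_A X` is `sort (X a_k)`,
where `a_k` is the `k`-th column of `A`. -/
noncomputable def betaEmb {n d D : ℕ} (A : Matrix (Fin d) (Fin D) ℝ)
    (X : Matrix (Fin n) (Fin d) ℝ) : Matrix (Fin n) (Fin D) ℝ :=
  Matrix.of fun i k => sortVec (X.mulVec fun l => A l k) i

/-- Frobenius norm of a real matrix. -/
noncomputable def frob {n m : ℕ} (M : Matrix (Fin n) (Fin m) ℝ) : ℝ :=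
  Real.sqrt (∑ i, ∑ j, (M i j) ^ 2)

/-- `dist(X,Y) = min_{σ ∈ S_n} ‖X - σY‖_F`, where `σ` acts by permuting rows. -/
noncomputable def permDist {n d : ℕ} (X Y : Matrix (Fin n) (Fin d) ℝ) : ℝ :=
  ⨅ σ : Equiv.Perm (Fin n), frob (X - Y.submatrix σ id)
/-- The `k`-th (1-based) of `D` equispaced unit vectors on the circle:
`a_k = (cos(2πk/D), sin(2πk/D))`. -/
noncomputable def circCol (D : ℕ) (k : Fin D) : Fin 2 → ℝ :=
  ![Real.cos (2 * Real.pi * ((k : ℕ) + 1) / D), Real.sin (2 * Real.pi * ((k : ℕ) + 1) / D)]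

open Real in
/-- Inner product of `z` with the unit vector at angle `t`. -/
noncomputable def dirProj (t : ℝ) (z : Fin 2 → ℝ) : ℝ := cos t * z 0 + sin t * z 1

/-- Squared distance between the sorted projections of the rows of `X` and `Y` in direction `t`. -/
noncomputable def sortGap {n : ℕ} (X Y : Matrix (Fin n) (Fin 2) ℝ) (t : ℝ) : ℝ :=
  ∑ i, (sortVec (fun i => dirProj t (X i)) i - sortVec (fun i => dirProj t (Y i)) i) ^ 2

lemma dirProj_sub (t : ℝ) (z w : Fin 2 → ℝ) : dirProj t (z - w) = dirProj t z - dirProj t w := by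
  simp only [dirProj, Pi.sub_apply]; ring

lemma dirProj_add_pi (t : ℝ) (z : Fin 2 → ℝ) : dirProj (t + Real.pi) z = -dirProj t z := by
  simp only [dirProj, Real.cos_add_pi, Real.sin_add_pi]; ring

lemma dirProj_add_two_pi (t : ℝ) (z : Fin 2 → ℝ) : dirProj (t + 2 * Real.pi) z = dirProj t z := by
  simp only [dirProj, Real.cos_add_two_pi, Real.sin_add_two_pi]

lemma dirProj_sq_add_sq (t : ℝ) (z : Fin 2 → ℝ) :
    dirProj t z ^ 2 + dirProj (t + Real.pi / 2) z ^ 2 = z 0 ^ 2 + z 1 ^ 2 := by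
  simp only [dirProj, Real.cos_add_pi_div_two, Real.sin_add_pi_div_two]
  linear_combination (z 0 ^ 2 + z 1 ^ 2) * Real.sin_sq_add_cos_sq t

lemma one_sub_cos_mul_le_dirProj_sq_add (t θ : ℝ) (hθ : 0 ≤ Real.cos θ) (z : Fin 2 → ℝ) :
    (1 - Real.cos θ) * (z 0 ^ 2 + z 1 ^ 2) ≤ dirProj t z ^ 2 + dirProj (t + θ) z ^ 2 := by
  set q := dirProj (t + Real.pi / 2) z with hq
  have h1 := dirProj_sq_add_sq t z
  have h2 : dirProj (t + θ) z = dirProj t z * Real.cos θ + q * Real.sin θ := by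
    simp only [hq, dirProj, Real.cos_add_pi_div_two, Real.sin_add_pi_div_two]
    rw [Real.cos_add, Real.sin_add]
    ring
  rw [h2, ← h1, ← hq]
  set p := dirProj t z
  have h3 := Real.sin_sq_add_cos_sq θ
  set c := Real.cos θ
  set s := Real.sin θ
  have h4 : 0 ≤ c * ((1 + c) * p + s * q) ^ 2 := by positivity
  have h5 : c * ((1 + c) * p + s * q) ^ 2 =
      (1 + c) * (p ^ 2 + (p * c + q * s) ^ 2 - (1 - c) * (p ^ 2 + q ^ 2)) := by
    linear_combination (-q ^ 2) * h3
  rw [h5] at h4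
  have := nonneg_of_mul_nonneg_right h4 (by positivity)
  linarith

lemma sum_dirProj_sq (N : ℕ) (hN : 1 ≤ N) (z : Fin 2 → ℝ) :
    ∑ k ∈ Finset.range (4 * N), dirProj (Real.pi / (2 * N) * ((k : ℝ) + 1)) z ^ 2 =
      2 * N * (z 0 ^ 2 + z 1 ^ 2) := by
  have hN' : (N : ℝ) ≠ 0 := by positivity
  set g : ℕ → ℝ := fun k => dirProj (Real.pi / (2 * N) * ((k : ℝ) + 1)) z ^ 2 with hg
  have h : ∀ k, g k + g (N + k) = z 0 ^ 2 + z 1 ^ 2 := by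
    intro k
    have h1 : Real.pi / (2 * N) * (((N + k : ℕ) : ℝ) + 1) =
        Real.pi / (2 * N) * ((k : ℝ) + 1) + Real.pi / 2 := by
      push_cast; field_simp; ring
    simp only [hg]
    rw [h1, dirProj_sq_add_sq]
  have e : 4 * N = (N + N) + (N + N) := by ring
  change ∑ k ∈ Finset.range (4 * N), g k = _
  rw [e, Finset.sum_range_add, Finset.sum_range_add, Finset.sum_range_add, ← Finset.sum_add_distrib,
    ← Finset.sum_add_distrib]
  have h' : ∀ k, g (N + N + k) + g (N + N + (N + k)) = z 0 ^ 2 + z 1 ^ 2 := by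
    intro k
    have := h (N + N + k)
    rwa [← add_assoc N (N + N) k, add_comm N (N + N), add_assoc (N + N) N k] at this
  simp only [h, h', Finset.sum_const, Finset.card_range, nsmul_eq_mul]
  ring

lemma sortVec_eq_comp {n : ℕ} (v : Fin n → ℝ) (σ : Equiv.Perm (Fin n)) (h : Monotone (v ∘ σ)) :
    sortVec v = v ∘ σ :=
  (Tuple.comp_sort_eq_comp_iff_monotone.2 h).symm ▸ rfl

lemma sum_sortVec_sub_sq_le {n : ℕ} (v w : Fin n → ℝ) (ρ : Equiv.Perm (Fin n)) :
    ∑ i, (sortVec v i - sortVec w i) ^ 2 ≤ ∑ i, (v i - w (ρ i)) ^ 2 := by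
  set σ := Tuple.sort v with hσ
  set τ := Tuple.sort w with hτ
  have hm : Monovary (v ∘ σ) (w ∘ τ) :=
    (Tuple.monotone_sort v).monovary (Tuple.monotone_sort w)
  have h := hm.sum_mul_comp_perm_le_sum_mul (σ := (σ.trans ρ).trans τ.symm)
  simp only [Function.comp_apply, Equiv.trans_apply, Equiv.apply_symm_apply] at h
  rw [← Equiv.sum_comp σ fun i => (v i - w (ρ i)) ^ 2]
  have h1 : ∑ i, w (ρ (σ i)) ^ 2 = ∑ i, w (τ i) ^ 2 := by
    rw [Equiv.sum_comp σ fun i => w (ρ i) ^ 2, Equiv.sum_comp ρ fun i => w i ^ 2,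
      Equiv.sum_comp τ fun i => w i ^ 2]
  simp only [sortVec, Function.comp_apply, ← hσ, ← hτ, sub_sq, Finset.sum_add_distrib,
    Finset.sum_sub_distrib, mul_assoc, ← Finset.mul_sum]
  linarith

lemma frob_sq {n m : ℕ} (M : Matrix (Fin n) (Fin m) ℝ) : frob M ^ 2 = ∑ i, ∑ j, M i j ^ 2 :=
  Real.sq_sqrt (by positivity)

lemma permDist_nonneg {n d : ℕ} (X Y : Matrix (Fin n) (Fin d) ℝ) : 0 ≤ permDist X Y :=
  Real.iInf_nonneg fun _ => Real.sqrt_nonneg _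

lemma permDist_le {n d : ℕ} (X Y : Matrix (Fin n) (Fin d) ℝ) (σ : Equiv.Perm (Fin n)) :
    permDist X Y ≤ frob (X - Y.submatrix σ id) :=
  ciInf_le ⟨0, by rintro _ ⟨σ, rfl⟩; exact Real.sqrt_nonneg _⟩ σ

lemma exists_permDist_eq {n d : ℕ} (X Y : Matrix (Fin n) (Fin d) ℝ) :
    ∃ σ : Equiv.Perm (Fin n), frob (X - Y.submatrix σ id) = permDist X Y :=
  exists_eq_ciInf_of_finite

lemma permDist_sq_le {n : ℕ} (X Y : Matrix (Fin n) (Fin 2) ℝ) (σ τ : Equiv.Perm (Fin n)) :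
    permDist X Y ^ 2 ≤ ∑ i, ((X (σ i) - Y (τ i)) 0 ^ 2 + (X (σ i) - Y (τ i)) 1 ^ 2) := by
  have h := pow_le_pow_left₀ (permDist_nonneg X Y) (permDist_le X Y (σ.symm.trans τ)) 2
  rw [frob_sq, ← Equiv.sum_comp σ] at h
  simpa [Fin.sum_univ_two] using h

lemma frob_betaEmb_sub_sq (n : ℕ) (hn : 1 ≤ n) (X Y : Matrix (Fin n) (Fin 2) ℝ) :
    frob (betaEmb (Matrix.of fun i (k : Fin (4 * n ^ 2)) => circCol (4 * n ^ 2) k i) X -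
        betaEmb (Matrix.of fun i (k : Fin (4 * n ^ 2)) => circCol (4 * n ^ 2) k i) Y) ^ 2 =
      ∑ k ∈ Finset.range (4 * n ^ 2),
        sortGap X Y (Real.pi / (2 * (n ^ 2 : ℕ)) * ((k : ℝ) + 1)) := by
  have hn' : (n : ℝ) ≠ 0 := by positivity
  rw [frob_sq, Finset.sum_comm, Finset.sum_range]
  refine Finset.sum_congr rfl fun k _ => ?_
  have ha : 2 * Real.pi * ((k : ℕ) + 1) / (4 * n ^ 2 : ℕ) =
      Real.pi / (2 * (n ^ 2 : ℕ)) * (((k : ℕ) : ℝ) + 1) := by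
    push_cast; field_simp; ring
  have hX : ∀ Z : Matrix (Fin n) (Fin 2) ℝ, (Z.mulVec fun l => circCol (4 * n ^ 2) k l) =
      fun i => dirProj (Real.pi / (2 * (n ^ 2 : ℕ)) * (((k : ℕ) : ℝ) + 1)) (Z i) := by
    intro Z
    ext i
    simp only [Matrix.mulVec, dotProduct, Fin.sum_univ_two, circCol, ha, dirProj]
    simp [mul_comm]
  simp only [sortGap, betaEmb, Matrix.sub_apply, Matrix.of_apply, hX]

lemma exists_perm_monotone_dirProj {n : ℕ} (X : Matrix (Fin n) (Fin 2) ℝ) (s t : ℝ)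
    (h : ∀ i j, ¬(dirProj s (X i - X j) < 0 ∧ 0 < dirProj t (X i - X j))) :
    ∃ σ : Equiv.Perm (Fin n), Monotone ((fun i => dirProj s (X i)) ∘ σ) ∧
      Monotone ((fun i => dirProj t (X i)) ∘ σ) := by
  simp only [dirProj_sub] at h
  refine ⟨Tuple.sort fun i => dirProj s (X i) + dirProj t (X i), ?_, ?_⟩ <;> intro i j hij <;>
  · have hm := Tuple.monotone_sort (fun i => dirProj s (X i) + dirProj t (X i)) hij
    simp only [Function.comp_apply] at hm ⊢
    set a := Tuple.sort (fun i => dirProj s (X i) + dirProj t (X i)) i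
    set b := Tuple.sort (fun i => dirProj s (X i) + dirProj t (X i)) j
    by_contra! hc
    have h1 := h a b
    have h2 := h b a
    by_cases h3 : dirProj s (X a) - dirProj s (X b) < 0
    · exact h1 ⟨h3, by linarith⟩
    · exact h2 ⟨by linarith, by linarith⟩

lemma one_sub_cos_mul_permDist_sq_le {n : ℕ} (X Y : Matrix (Fin n) (Fin 2) ℝ) (t θ : ℝ)
    (hθ : 0 ≤ Real.cos θ)
    (hX : ∀ i j, ¬(dirProj t (X i - X j) < 0 ∧ 0 < dirProj (t + θ) (X i - X j)))
    (hY : ∀ i j, ¬(dirProj t (Y i - Y j) < 0 ∧ 0 < dirProj (t + θ) (Y i - Y j))) :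
    (1 - Real.cos θ) * permDist X Y ^ 2 ≤ sortGap X Y t + sortGap X Y (t + θ) := by
  obtain ⟨σ, hX1, hX2⟩ := exists_perm_monotone_dirProj X _ _ hX
  obtain ⟨τ, hY1, hY2⟩ := exists_perm_monotone_dirProj Y _ _ hY
  have hc : 0 ≤ 1 - Real.cos θ := by linarith [Real.cos_le_one θ]
  refine (mul_le_mul_of_nonneg_left (permDist_sq_le X Y σ τ) hc).trans ?_
  rw [sortGap, sortGap, sortVec_eq_comp _ _ hX1, sortVec_eq_comp _ _ hX2, sortVec_eq_comp _ _ hY1,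
    sortVec_eq_comp _ _ hY2, ← Finset.sum_add_distrib, Finset.mul_sum]
  refine Finset.sum_le_sum fun i _ => ?_
  simp only [Function.comp_apply, ← dirProj_sub]
  exact one_sub_cos_mul_le_dirProj_sq_add t θ hθ _

lemma dirProj_pos_of_ascending (t θ : ℝ) (z : Fin 2 → ℝ) (h1 : dirProj t z < 0)
    (h2 : 0 < dirProj (t + θ) z) (j : ℕ) (hj : 1 ≤ j) (hθ : 0 < θ) (hjθ : j * θ ≤ Real.pi)
    (hθ' : θ < Real.pi) :
    0 < dirProj (t + j * θ) z := by
  have hs : 0 < Real.sin θ := Real.sin_pos_of_pos_of_lt_pi hθ hθ'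
  have key : dirProj (t + j * θ) z * Real.sin θ =
      dirProj (t + θ) z * Real.sin (j * θ) - dirProj t z * Real.sin ((j - 1) * θ) := by
    have : ((j : ℝ) - 1) * θ = j * θ - θ := by ring
    simp only [dirProj, this, Real.cos_add, Real.sin_add, Real.sin_sub]
    ring
  have hj' : (1 : ℝ) ≤ j := by exact_mod_cast hj
  have hb : 0 ≤ Real.sin ((j - 1) * θ) :=
    Real.sin_nonneg_of_nonneg_of_le_pi (by nlinarith) (by nlinarith)
  have ha : 0 ≤ Real.sin (j * θ) :=
    Real.sin_nonneg_of_nonneg_of_le_pi (by positivity) hjθ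
  have hpos : 0 < dirProj (t + j * θ) z * Real.sin θ := by
    rw [key]
    rcases hjθ.lt_or_eq with hlt | heq
    · have : 0 < Real.sin (j * θ) := Real.sin_pos_of_pos_of_lt_pi (by nlinarith) hlt
      nlinarith [mul_pos h2 this, mul_nonneg (neg_nonneg.2 h1.le) hb]
    · have : Real.sin ((j - 1) * θ) = Real.sin θ := by
        rw [show ((j : ℝ) - 1) * θ = Real.pi - θ by linarith, Real.sin_pi_sub]
      rw [this]
      nlinarith [mul_nonneg h2.le ha, mul_pos (neg_pos.2 h1) hs]
  exact pos_of_mul_pos_left hpos hs.le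

lemma ascending_unique (M : ℕ) (hM : 2 ≤ M) (z : Fin 2 → ℝ) (k l : ℕ) (hkl : k < l)
    (hl : l < 2 * M) (θ : ℝ) (hθ : M * θ = Real.pi)
    (hk1 : dirProj (θ * ((k : ℝ) + 1)) z < 0) (hk2 : 0 < dirProj (θ * ((k : ℝ) + 1) + θ) z)
    (hl1 : dirProj (θ * ((l : ℝ) + 1)) z < 0) (hl2 : 0 < dirProj (θ * ((l : ℝ) + 1) + θ) z) :
    False := by
  have hM' : (2 : ℝ) ≤ M := by exact_mod_cast hM
  have hθ0 : 0 < θ := pos_of_mul_pos_right (hθ ▸ Real.pi_pos) (by positivity)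
  have hθ1 : θ < Real.pi := by nlinarith
  have hpos := fun j hj hjM => dirProj_pos_of_ascending _ θ z hk1 hk2 j hj hθ0 hjM hθ1
  obtain ⟨j, rfl⟩ := Nat.exists_eq_add_of_lt hkl
  rcases le_or_gt (j + 1) M with hj | hj
  · have hj' : ((j + 1 : ℕ) : ℝ) ≤ M := by exact_mod_cast hj
    have := hpos (j + 1) (by omega) (by nlinarith)
    push_cast at this hl1
    rw [show θ * ((k : ℝ) + 1) + (j + 1) * θ = θ * (k + j + 1 + 1) by ring] at this
    linarith
  · obtain ⟨i, rfl⟩ : ∃ i, j = M + i := ⟨j - M, by omega⟩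
    have hj' : ((i + 2 : ℕ) : ℝ) ≤ M := by exact_mod_cast (by omega : i + 2 ≤ M)
    have := hpos (i + 2) (by omega) (by nlinarith)
    push_cast at this hl2
    rw [show θ * ((k : ℝ) + (M + i) + 1 + 1) + θ = θ * (k + 1) + (i + 2) * θ + Real.pi by
      rw [← hθ]; ring, dirProj_add_pi] at hl2
    linarith

open Classical in
lemma card_ascending_le {n : ℕ} (M : ℕ) (hM : 2 ≤ M) (θ : ℝ) (hθ : M * θ = Real.pi)
    (X : Matrix (Fin n) (Fin 2) ℝ) :
    ((Finset.range (2 * M)).filter fun k : ℕ => ∃ i j,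
      dirProj (θ * ((k : ℝ) + 1)) (X i - X j) < 0 ∧
        0 < dirProj (θ * ((k : ℝ) + 1) + θ) (X i - X j)).card ≤ n ^ 2 := by
  have hsub : ((Finset.range (2 * M)).filter fun k : ℕ => ∃ i j,
      dirProj (θ * ((k : ℝ) + 1)) (X i - X j) < 0 ∧
        0 < dirProj (θ * ((k : ℝ) + 1) + θ) (X i - X j)) ⊆
      (Finset.univ : Finset (Fin n × Fin n)).biUnion fun p =>
        (Finset.range (2 * M)).filter fun k : ℕ =>
          dirProj (θ * ((k : ℝ) + 1)) (X p.1 - X p.2) < 0 ∧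
            0 < dirProj (θ * ((k : ℝ) + 1) + θ) (X p.1 - X p.2) := by
    intro k hk
    simp only [Finset.mem_filter, Finset.mem_biUnion, Finset.mem_univ, true_and] at hk ⊢
    obtain ⟨hk, i, j, h⟩ := hk
    exact ⟨(i, j), hk, h⟩
  refine (Finset.card_le_card hsub).trans ((Finset.card_biUnion_le_card_mul _ _ 1 ?_).trans ?_)
  · intro p _
    refine Finset.card_le_one.2 fun k hk l hl => ?_
    simp only [Finset.mem_filter, Finset.mem_range] at hk hl
    rcases lt_trichotomy k l with h | h | h
    · exact (ascending_unique M hM _ k l h hl.1 θ hθ hk.2.1 hk.2.2 hl.2.1 hl.2.2).elim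
    · exact h
    · exact (ascending_unique M hM _ l k h hk.1 θ hθ hl.2.1 hl.2.2 hk.2.1 hk.2.2).elim
  · simp [sq]

lemma sortGap_nonneg {n : ℕ} (X Y : Matrix (Fin n) (Fin 2) ℝ) (t : ℝ) : 0 ≤ sortGap X Y t :=
  Finset.sum_nonneg fun _ _ => sq_nonneg _

open Classical in
lemma le_sum_sortGap {n : ℕ} (hn : 1 ≤ n) (X Y : Matrix (Fin n) (Fin 2) ℝ) :
    permDist X Y ^ 2 / (2 * n ^ 2) ≤ ∑ k ∈ Finset.range (4 * n ^ 2),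
        sortGap X Y (Real.pi / (2 * (n ^ 2 : ℕ)) * ((k : ℝ) + 1)) := by
  have hn1 : (1 : ℝ) ≤ n := by exact_mod_cast hn
  have hn2 : 1 ≤ n ^ 2 := Nat.one_le_pow _ _ hn
  set θ : ℝ := Real.pi / (2 * (n ^ 2 : ℕ)) with hθ
  have hM : ((2 * n ^ 2 : ℕ) : ℝ) * θ = Real.pi := by
    rw [hθ]; push_cast; field_simp
  have hθ0 : 0 < θ := by rw [hθ]; have := Real.pi_pos; positivity
  have hθ2 : θ ≤ Real.pi / 2 := by
    push_cast at hM
    nlinarith [one_le_pow₀ hn1 (n := 2)]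
  have hc0 : 0 ≤ Real.cos θ := Real.cos_nonneg_of_mem_Icc ⟨by linarith [Real.pi_pos], hθ2⟩
  have hcos : 1 / (2 * (n : ℝ) ^ 4) ≤ 1 - Real.cos θ := by
    have h1 := Real.mul_le_sin (x := θ / 2) (by linarith) (by linarith [Real.pi_pos])
    have h2 : 2 / Real.pi * (θ / 2) = 1 / (2 * (n : ℝ) ^ 2) := by
      rw [hθ]; push_cast; field_simp
    have h3 : Real.cos θ = 1 - 2 * Real.sin (θ / 2) ^ 2 := by
      have := Real.cos_two_mul (θ / 2)
      rw [show 2 * (θ / 2) = θ by ring] at this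
      linarith [Real.sin_sq_add_cos_sq (θ / 2)]
    rw [h2] at h1
    have h4 := pow_le_pow_left₀ (by positivity) h1 2
    have h5 : (1 / (2 * (n : ℝ) ^ 2)) ^ 2 = 1 / (2 * (n : ℝ) ^ 4) / 2 := by field_simp
    linarith
  set F : ℕ → ℝ := fun k => sortGap X Y (θ * ((k : ℝ) + 1)) with hF
  have hFs : ∀ k : ℕ, F (k + 1) = sortGap X Y (θ * ((k : ℝ) + 1) + θ) := by
    intro k; simp only [hF]; congr 1; push_cast; ring
  have hper : F (4 * n ^ 2) = F 0 := by
    simp only [hF, sortGap]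
    rw [show θ * (((4 * n ^ 2 : ℕ) : ℝ) + 1) = θ * (((0 : ℕ) : ℝ) + 1) + 2 * Real.pi by
      rw [← hM]; push_cast; ring]
    simp only [dirProj_add_two_pi]
  have hshift : ∑ k ∈ Finset.range (4 * n ^ 2), F (k + 1) = ∑ k ∈ Finset.range (4 * n ^ 2), F k := by
    have h1 := Finset.sum_range_succ F (4 * n ^ 2)
    have h2 := Finset.sum_range_succ' F (4 * n ^ 2)
    linarith
  let asc : Matrix (Fin n) (Fin 2) ℝ → Finset ℕ := fun Z =>
    (Finset.range (2 * (2 * n ^ 2))).filter fun k : ℕ => ∃ i j,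
      dirProj (θ * ((k : ℝ) + 1)) (Z i - Z j) < 0 ∧
        0 < dirProj (θ * ((k : ℝ) + 1) + θ) (Z i - Z j)
  have hasc : ∀ Z, (asc Z).card ≤ n ^ 2 := card_ascending_le (2 * n ^ 2) (by omega) θ hM
  set G := Finset.range (4 * n ^ 2) \ (asc X ∪ asc Y) with hG
  have hGcard : 2 * n ^ 2 ≤ G.card := by
    have h1 := Finset.le_card_sdiff (asc X ∪ asc Y) (Finset.range (4 * n ^ 2))
    have h2 := Finset.card_union_le (asc X) (asc Y)
    have h3 := hasc X
    have h4 := hasc Y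
    rw [Finset.card_range, ← hG] at h1
    omega
  have hGk : ∀ k ∈ G, (1 - Real.cos θ) * permDist X Y ^ 2 ≤ F k + F (k + 1) := by
    intro k hk
    rw [hFs]
    simp only [hG, Finset.mem_sdiff, Finset.mem_union, not_or, asc, Finset.mem_filter,
      Finset.mem_range, not_and] at hk
    obtain ⟨hk0, hkX, hkY⟩ := hk
    have hkX := hkX (by omega)
    have hkY := hkY (by omega)
    exact one_sub_cos_mul_permDist_sq_le X Y _ θ hc0
      (fun i j h => hkX ⟨i, j, h⟩) (fun i j h => hkY ⟨i, j, h⟩)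
  have hsum : G.card * ((1 - Real.cos θ) * permDist X Y ^ 2) ≤
      2 * ∑ k ∈ Finset.range (4 * n ^ 2), F k := by
    calc _ ≤ ∑ k ∈ G, (F k + F (k + 1)) := by
          rw [← nsmul_eq_mul]; exact Finset.card_nsmul_le_sum _ _ _ hGk
      _ ≤ ∑ k ∈ Finset.range (4 * n ^ 2), (F k + F (k + 1)) :=
          Finset.sum_le_sum_of_subset_of_nonneg Finset.sdiff_subset fun _ _ _ =>
            add_nonneg (sortGap_nonneg _ _ _) (sortGap_nonneg _ _ _)
      _ = _ := by rw [Finset.sum_add_distrib, hshift]; ring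
  have hGc : 2 * (n : ℝ) ^ 2 ≤ G.card := by exact_mod_cast hGcard
  have hfin : 2 * (n : ℝ) ^ 2 * (1 / (2 * (n : ℝ) ^ 4) * permDist X Y ^ 2) ≤
      G.card * ((1 - Real.cos θ) * permDist X Y ^ 2) := by gcongr
  have he : 2 * (n : ℝ) ^ 2 * (1 / (2 * (n : ℝ) ^ 4) * permDist X Y ^ 2) =
      2 * (permDist X Y ^ 2 / (2 * n ^ 2)) := by field_simp
  linarith

lemma sum_sortGap_le {n : ℕ} (hn : 1 ≤ n) (X Y : Matrix (Fin n) (Fin 2) ℝ) :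
    ∑ k ∈ Finset.range (4 * n ^ 2),
        sortGap X Y (Real.pi / (2 * (n ^ 2 : ℕ)) * ((k : ℝ) + 1)) ≤
      2 * n ^ 2 * permDist X Y ^ 2 := by
  obtain ⟨σ, hσ⟩ := exists_permDist_eq X Y
  have h : ∀ t, sortGap X Y t ≤ ∑ i, dirProj t (X i - Y (σ i)) ^ 2 := fun t => by
    simp only [dirProj_sub]
    exact sum_sortVec_sub_sq_le _ _ σ
  refine (Finset.sum_le_sum fun k _ => h _).trans ?_
  rw [Finset.sum_comm, ← hσ, frob_sq, Finset.mul_sum]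
  simp only [sum_dirProj_sq (n ^ 2) (Nat.one_le_pow _ _ hn), Fin.sum_univ_two]
  simp

/-- For `D = 4n²` and `A` the matrix of `D` equispaced unit vectors on the circle,
`β_A` is bi-Lipschitz with lower constant `1/(√2·n)` and upper constant `√2·n`; hence its
distortion is at most `2n²`. -/
theorem stmt9 (n : ℕ) (hn : 1 ≤ n) (X Y : Matrix (Fin n) (Fin 2) ℝ) :
    (1 / (Real.sqrt 2 * n)) * permDist X Y ≤
      frob (betaEmb (Matrix.of fun i (k : Fin (4 * n ^ 2)) => circCol (4 * n ^ 2) k i) X -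
        betaEmb (Matrix.of fun i (k : Fin (4 * n ^ 2)) => circCol (4 * n ^ 2) k i) Y) ∧
    frob (betaEmb (Matrix.of fun i (k : Fin (4 * n ^ 2)) => circCol (4 * n ^ 2) k i) X -
        betaEmb (Matrix.of fun i (k : Fin (4 * n ^ 2)) => circCol (4 * n ^ 2) k i) Y) ≤
      Real.sqrt 2 * n * permDist X Y := by
  have hn0 : (0 : ℝ) < n := by exact_mod_cast hn
  have h2 : Real.sqrt 2 ^ 2 = 2 := Real.sq_sqrt (by norm_num)
  have hf := frob_betaEmb_sub_sq n hn X Y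
  have hd := permDist_nonneg X Y
  constructor
  · refine le_of_abs_le (abs_le_of_sq_le_sq ?_ (Real.sqrt_nonneg _))
    rw [hf, mul_pow, div_pow, mul_pow, h2]
    refine le_trans (le_of_eq ?_) (le_sum_sortGap hn X Y)
    ring
  · refine le_of_abs_le (abs_le_of_sq_le_sq ?_ (by positivity))
    rw [hf, mul_pow, mul_pow, h2]
    exact sum_sortGap_le hn X Y
end

section
/- There exists an absolute constant C > 0 with the following property. Let d, n, D be natural numbers with D ≥ C·n⁴·d, and let A ∈ ℝ^{d×D} be a random matrix whose entries are independent standard normal random variables. Then with probability at least 1 − exp(−(8/81)·D/n⁴), it holds that for all X, Y ∈ ℝ^{n×d}, ‖β_A(X) − β_A(Y)‖_F ≥ (√(2π)/(9√3)) · (√D/n²) · dist(X,Y). -/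
open Matrix MeasureTheory

open ProbabilityTheory WithLp

/-- The law of a `d × D` matrix with i.i.d. standard Gaussian entries. -/
noncomputable abbrev gaussianMatrix (d D : ℕ) : Measure (Fin d → Fin D → ℝ) :=
  Measure.pi fun _ : Fin d => Measure.pi fun _ : Fin D => gaussianReal 0 1

theorem gaussianMatrix_map_sum {d D : ℕ} (z : EuclideanSpace ℝ (Fin d)) (hz : ‖z‖ = 1) :
    (gaussianMatrix d D).map (fun A => toLp 2 fun k => ∑ l, z l * A l k) =
      stdGaussian (EuclideanSpace ℝ (Fin D)) := by
  have hm : Measurable (fun A : Fin d → Fin D → ℝ => toLp 2 fun k => ∑ l, z l * A l k) := by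
    fun_prop
  apply Measure.ext_of_charFun (E := EuclideanSpace ℝ (Fin D))
  ext t
  rw [charFun_stdGaussian, charFun_apply, integral_map hm.aemeasurable (by fun_prop)]
  have h1 : ∀ A : Fin d → Fin D → ℝ,
      Complex.exp (inner ℝ (toLp 2 fun k => ∑ l, z l * A l k) t * Complex.I) =
        ∏ l, Complex.exp (inner ℝ (toLp 2 (A l)) (z l • t) * Complex.I) := by
    intro A
    rw [← Complex.exp_sum, ← Finset.sum_mul, ← Complex.ofReal_sum]
    congr 3
    simp only [PiLp.inner_apply, RCLike.inner_apply, conj_trivial, PiLp.smul_apply, smul_eq_mul,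
      Finset.mul_sum]
    rw [Finset.sum_comm]
    refine Finset.sum_congr rfl fun l _ => Finset.sum_congr rfl fun k _ => by ring
  simp_rw [h1]
  rw [integral_fintype_prod_eq_prod
    (f := fun l (a : Fin D → ℝ) => Complex.exp (inner ℝ (toLp 2 a) (z l • t) * Complex.I))]
  have h2 : ∀ l, ∫ a : Fin D → ℝ, Complex.exp (inner ℝ (toLp 2 a) (z l • t) * Complex.I)
      ∂(Measure.pi fun _ : Fin D => gaussianReal 0 1) =
        Complex.exp (- ‖z l • t‖ ^ 2 / 2) := by
    intro l
    rw [← charFun_stdGaussian, ← map_pi_eq_stdGaussian, charFun_apply,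
      integral_map (by fun_prop) (by fun_prop)]
  simp_rw [h2]
  rw [← Complex.exp_sum]
  congr 1
  have h3 : ∑ l, (z l) ^ 2 = 1 := by
    rw [← EuclideanSpace.real_norm_sq_eq, hz, one_pow]
  rw [← Finset.sum_div, Finset.sum_neg_distrib]
  congr 2
  norm_cast
  simp_rw [norm_smul, mul_pow, Real.norm_eq_abs, sq_abs]
  rw [← Finset.sum_mul, h3, one_mul]

theorem lintegral_prod_gaussianMatrix {d D : ℕ} (z : EuclideanSpace ℝ (Fin d)) (hz : ‖z‖ = 1)
    {f : ℝ → ENNReal} (hf : Measurable f) :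
    ∫⁻ A, ∏ k, f (∑ l, z l * A l k) ∂(gaussianMatrix d D) =
      (∫⁻ x, f x ∂(gaussianReal 0 1)) ^ D := by
  have hm : Measurable (fun A : Fin d → Fin D → ℝ => toLp 2 fun k => ∑ l, z l * A l k) := by
    fun_prop
  have hg : Measurable fun x : EuclideanSpace ℝ (Fin D) => ∏ k, f (x k) :=
    Finset.measurable_fun_prod _ fun k _ => hf.comp (by fun_prop)
  have h := lintegral_map (μ := gaussianMatrix d D) hg hm
  rw [gaussianMatrix_map_sum z hz, ← map_pi_eq_stdGaussian, lintegral_map hg (by fun_prop)] at h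
  rw [← h]
  have hi : iIndepFun (fun (k : Fin D) (ω : Fin D → ℝ) => f (ω k))
      (Measure.pi fun _ : Fin D => gaussianReal 0 1) :=
    iIndepFun_pi (X := fun _ => f) fun _ => hf.aemeasurable
  have h2 := lintegral_prod_eq_prod_lintegral_of_indepFun Finset.univ _ hi
    (fun k => hf.comp (measurable_pi_apply k))
  simp only at h2 ⊢
  rw [h2]
  have h3 : ∀ k : Fin D, ∫⁻ ω, f (ω k) ∂(Measure.pi fun _ : Fin D => gaussianReal 0 1) =
      ∫⁻ x, f x ∂(gaussianReal 0 1) := fun k =>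
    (measurePreserving_eval (fun _ : Fin D => gaussianReal 0 1) k).lintegral_comp hf
  simp [h3]

theorem measure_prod_ge_le {d D : ℕ} (z : EuclideanSpace ℝ (Fin d)) (hz : ‖z‖ = 1)
    {f : ℝ → ℝ} (hf : Measurable f) (hf0 : ∀ x, 0 ≤ f x) {a c : ℝ} (ha : 0 ≤ a) (hc : 0 < c)
    (hfa : ∫⁻ x, ENNReal.ofReal (f x) ∂(gaussianReal 0 1) ≤ ENNReal.ofReal a) :
    gaussianMatrix d D {A | c ≤ ∏ k, f (∑ l, z l * A l k)} ≤ ENNReal.ofReal (a ^ D / c) := by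
  have hf' : Measurable fun x => ENNReal.ofReal (f x) := hf.ennreal_ofReal
  have h := mul_meas_ge_le_lintegral (μ := gaussianMatrix d D)
    (f := fun A => ∏ k, ENNReal.ofReal (f (∑ l, z l * A l k)))
    (Finset.measurable_fun_prod _ fun k _ => hf'.comp (by fun_prop)) (ENNReal.ofReal c)
  rw [lintegral_prod_gaussianMatrix z hz hf'] at h
  have hc0 : ENNReal.ofReal c ≠ 0 := by simpa using hc
  rw [ENNReal.ofReal_div_of_pos hc, ENNReal.le_div_iff_mul_le (.inl hc0) (.inl ENNReal.ofReal_ne_top),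
    mul_comm, ENNReal.ofReal_pow ha]
  refine le_trans ?_ (h.trans (by gcongr))
  gcongr with A
  intro hA
  rw [← ENNReal.ofReal_prod_of_nonneg fun k _ => hf0 _]
  exact ENNReal.ofReal_le_ofReal hA

theorem gaussianReal_abs_le (r : ℝ) :
    gaussianReal 0 1 {x | |x| ≤ r} ≤ ENNReal.ofReal (2 * r / √(2 * Real.pi)) := by
  rw [gaussianReal_apply _ one_ne_zero]
  have h1 : ∀ x, gaussianPDF 0 1 x ≤ ENNReal.ofReal (1 / √(2 * Real.pi)) := by
    intro x
    refine ENNReal.ofReal_le_ofReal ?_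
    simp only [gaussianPDFReal, NNReal.coe_one, mul_one, sub_zero, one_div]
    refine mul_le_of_le_one_right (by positivity) ?_
    rw [Real.exp_le_one_iff]
    have := sq_nonneg x
    linarith
  refine (lintegral_mono h1).trans ?_
  have h2 : {x : ℝ | |x| ≤ r} = Set.Icc (-r) r := by ext x; simp [abs_le]
  rw [lintegral_const, Measure.restrict_apply_univ, h2, Real.volume_Icc,
    ← ENNReal.ofReal_mul (by positivity)]
  refine le_of_eq ?_
  congr 1
  ring

theorem measure_card_abs_le_gaussianMatrix {d D : ℕ} (z : EuclideanSpace ℝ (Fin d))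
    (hz : ‖z‖ = 1) {r p : ℝ} (hr : 0 ≤ r) (hp : 2 * r / √(2 * Real.pi) ≤ p) (m : ℝ) :
    gaussianMatrix d D
      {A | m ≤ (Finset.univ.filter fun k => |∑ l, z l * A l k| ≤ r).card} ≤
      ENNReal.ofReal (Real.exp (p * D - m * Real.log 2)) := by
  classical
  have hp0 : 0 ≤ p := le_trans (by positivity) hp
  set f : ℝ → ℝ := fun x => 1 + Set.indicator {x | |x| ≤ r} 1 x with hf
  have hS : MeasurableSet {x : ℝ | |x| ≤ r} := measurableSet_le (by fun_prop) (by fun_prop)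
  have hfm : Measurable f := measurable_const.add (measurable_one.indicator hS)
  have hi0 : ∀ x, 0 ≤ Set.indicator {x : ℝ | |x| ≤ r} (1 : ℝ → ℝ) x := fun x =>
    Set.indicator_nonneg (fun _ _ => zero_le_one) x
  have hfa : ∫⁻ x, ENNReal.ofReal (f x) ∂(gaussianReal 0 1) ≤ ENNReal.ofReal (1 + p) := by
    have h1 : ∀ x, ENNReal.ofReal (f x) = 1 + Set.indicator {x : ℝ | |x| ≤ r} 1 x := by
      intro x
      rw [hf, ENNReal.ofReal_add zero_le_one (hi0 x)]
      by_cases hx : |x| ≤ r <;> simp [Set.indicator, hx]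
    simp_rw [h1]
    rw [lintegral_add_left measurable_const, lintegral_indicator_one hS]
    simp only [lintegral_const, measure_univ, mul_one]
    rw [ENNReal.ofReal_add zero_le_one hp0, ENNReal.ofReal_one]
    gcongr
    exact (gaussianReal_abs_le r).trans (ENNReal.ofReal_le_ofReal hp)
  have h := measure_prod_ge_le (D := D) z hz hfm (fun x => add_nonneg zero_le_one (hi0 x))
    (by positivity) (Real.exp_pos (m * Real.log 2)) hfa
  refine le_trans (measure_mono ?_) (h.trans (ENNReal.ofReal_le_ofReal ?_))
  · intro A hA
    simp only [Set.mem_ofPred_eq] at hA ⊢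
    have h2 : ∏ k, f (∑ l, z l * A l k) =
        2 ^ (Finset.univ.filter fun k => |∑ l, z l * A l k| ≤ r).card := by
      rw [Finset.card_filter, ← Finset.prod_pow_eq_pow_sum]
      refine Finset.prod_congr rfl fun k _ => ?_
      by_cases hk : |∑ l, z l * A l k| ≤ r <;> norm_num [hf, Set.indicator, hk]
    rw [h2, ← Real.rpow_natCast, Real.rpow_def_of_pos two_pos, mul_comm m]
    gcongr
  · rw [Real.exp_sub, mul_comm p, Real.exp_nat_mul]
    gcongr
    linarith [Real.add_one_le_exp p]

theorem lintegral_exp_sq_div_four :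
    ∫⁻ x, ENNReal.ofReal (Real.exp (x ^ 2 / 4)) ∂(gaussianReal 0 1) = ENNReal.ofReal (√2) := by
  have hpi := Real.pi_pos
  rw [gaussianReal_of_var_ne_zero _ one_ne_zero,
    lintegral_withDensity_eq_lintegral_mul _ (measurable_gaussianPDF 0 1) (by fun_prop)]
  have h1 : ∀ x : ℝ, (gaussianPDF 0 1 * fun x => ENNReal.ofReal (Real.exp (x ^ 2 / 4))) x =
      ENNReal.ofReal ((√(2 * Real.pi))⁻¹ * Real.exp (-(1 / 4) * x ^ 2)) := by
    intro x
    rw [Pi.mul_apply, gaussianPDF, ← ENNReal.ofReal_mul (gaussianPDFReal_nonneg _ _ _),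
      gaussianPDFReal, mul_assoc, ← Real.exp_add]
    simp only [NNReal.coe_one, mul_one, sub_zero]
    congr 3
    ring
  simp_rw [h1]
  rw [← ofReal_integral_eq_lintegral_ofReal]
  · rw [integral_const_mul, integral_gaussian]
    congr 1
    rw [← Real.sqrt_inv, ← Real.sqrt_mul (by positivity)]
    congr 1
    field_simp
    norm_num
  · exact (integrable_exp_neg_mul_sq (by norm_num)).const_mul _
  · exact Filter.Eventually.of_forall fun x => by positivity

theorem measure_sum_sq_ge_gaussianMatrix {d D : ℕ} (z : EuclideanSpace ℝ (Fin d))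
    (hz : ‖z‖ = 1) :
    gaussianMatrix d D {A | 8 * (D : ℝ) ≤ ∑ k, (∑ l, z l * A l k) ^ 2} ≤
      ENNReal.ofReal (Real.exp (-D)) := by
  have h := measure_prod_ge_le (D := D) z hz (f := fun x => Real.exp (x ^ 2 / 4)) (by fun_prop)
    (fun x => (Real.exp_pos _).le) (Real.sqrt_nonneg 2) (Real.exp_pos (2 * D))
    lintegral_exp_sq_div_four.le
  refine le_trans (measure_mono ?_) (h.trans (ENNReal.ofReal_le_ofReal ?_))
  · intro A hA
    simp only [Set.mem_ofPred_eq] at hA ⊢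
    rw [← Real.exp_sum, ← Finset.sum_div]
    gcongr
    linarith
  · have h1 : √2 ≤ Real.exp 1 := by
      refine (Real.sqrt_le_left (by norm_num)).2 ?_ |>.trans (Real.add_one_le_exp 1)
      norm_num
    rw [div_le_iff₀ (Real.exp_pos _), ← Real.exp_add]
    calc √2 ^ D ≤ Real.exp 1 ^ D := by gcongr
      _ = Real.exp (-D + 2 * D) := by rw [← Real.exp_nat_mul]; congr 1; ring

open Module Metric in
theorem card_le_of_separated_of_norm_le_one {E : Type*} [NormedAddCommGroup E] [NormedSpace ℝ E]
    [FiniteDimensional ℝ E] {ε : ℝ} (hε : 0 < ε) (s : Finset E) (hs : ∀ c ∈ s, ‖c‖ ≤ 1)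
    (h : ∀ c ∈ s, ∀ d ∈ s, c ≠ d → ε ≤ ‖c - d‖) :
    (s.card : ℝ) ≤ (1 + 2 / ε) ^ finrank ℝ E := by
  borelize E
  let μ : Measure E := Measure.addHaar
  have δpos : 0 < ε / 2 := by positivity
  have ρpos : 0 < 1 + ε / 2 := by positivity
  have hd : Set.Pairwise (s : Set E) (Function.onFun Disjoint fun c => ball c (ε / 2)) := by
    rintro c hc d hd hcd
    apply ball_disjoint_ball
    rw [dist_eq_norm]
    linarith [h c hc d hd hcd]
  have hsub : ⋃ c ∈ s, ball c (ε / 2) ⊆ ball (0 : E) (1 + ε / 2) := by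
    refine Set.iUnion₂_subset fun x hx => ball_subset_ball' ?_
    rw [dist_zero_right]
    linarith [hs x hx]
  have hμ : (s.card : ENNReal) * ENNReal.ofReal ((ε / 2) ^ finrank ℝ E) * μ (ball 0 1) ≤
      ENNReal.ofReal ((1 + ε / 2) ^ finrank ℝ E) * μ (ball 0 1) := by
    rw [← μ.addHaar_ball_of_pos 0 ρpos]
    refine le_trans (le_of_eq ?_) (measure_mono hsub)
    rw [measure_biUnion_finset hd fun c _ => measurableSet_ball]
    simp only [μ.addHaar_ball_of_pos _ δpos, Finset.sum_const, nsmul_eq_mul, mul_assoc]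
  have hc : (s.card : ENNReal) * ENNReal.ofReal ((ε / 2) ^ finrank ℝ E) ≤
      ENNReal.ofReal ((1 + ε / 2) ^ finrank ℝ E) :=
    (ENNReal.mul_le_mul_iff_left (measure_ball_pos _ _ zero_lt_one).ne' measure_ball_lt_top.ne).1 hμ
  have hr := ENNReal.toReal_le_of_le_ofReal (pow_nonneg ρpos.le _) hc
  rw [ENNReal.toReal_mul, ENNReal.toReal_natCast, ENNReal.toReal_ofReal (by positivity),
    ← le_div_iff₀ (by positivity), ← div_pow] at hr
  have hq : 1 + 2 / ε = (1 + ε / 2) / (ε / 2) := by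
    field_simp
    ring
  rwa [hq]

theorem exists_net_unit_sphere {d : ℕ} {ε : ℝ} (hε : 0 < ε) :
    ∃ s : Finset (EuclideanSpace ℝ (Fin d)), (∀ c ∈ s, ‖c‖ = 1) ∧
      (s.card : ℝ) ≤ (1 + 2 / ε) ^ d ∧ ∀ x, ‖x‖ = 1 → ∃ c ∈ s, ‖x - c‖ ≤ ε := by
  classical
  let P : Finset (EuclideanSpace ℝ (Fin d)) → Prop := fun s =>
    (∀ c ∈ s, ‖c‖ = 1) ∧ ∀ c ∈ s, ∀ d ∈ s, c ≠ d → ε ≤ ‖c - d‖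
  have hP : ∀ s, P s → (s.card : ℝ) ≤ (1 + 2 / ε) ^ d := fun s hs => by
    simpa using card_le_of_separated_of_norm_le_one hε s (fun c hc => (hs.1 c hc).le) hs.2
  have hb : BddAbove {m | ∃ s, P s ∧ s.card = m} := by
    refine ⟨⌊(1 + 2 / ε) ^ d⌋₊, ?_⟩
    rintro _ ⟨s, hs, rfl⟩
    exact Nat.le_floor (hP s hs)
  obtain ⟨s, hs, hmax⟩ := Nat.sSup_mem (s := {m | ∃ s, P s ∧ s.card = m})
    ⟨0, ∅, by simp [P], rfl⟩ hb
  refine ⟨s, hs.1, hP s hs, fun x hx => ?_⟩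
  by_contra! hcon
  have hxs : x ∉ s := fun hxs => by simpa using (hcon x hxs).trans_le' hε.le
  have hins : P (insert x s) := by
    refine ⟨by simpa [hx] using hs.1, ?_⟩
    intro a ha c hc hac
    rcases Finset.mem_insert.1 ha with hax | ha <;> rcases Finset.mem_insert.1 hc with hcx | hc
    · exact absurd (hax.trans hcx.symm) hac
    · rw [hax]; exact (hcon c hc).le
    · rw [hcx, norm_sub_rev]; exact (hcon a ha).le
    · exact hs.2 a ha c hc hac
  have := le_csSup hb ⟨_, hins, rfl⟩
  rw [← hmax, Finset.card_insert_of_notMem hxs] at this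
  omega

theorem card_filter_le_of_net {d D : ℕ}
    (T : EuclideanSpace ℝ (Fin d) →L[ℝ] EuclideanSpace ℝ (Fin D))
    {s : Set (EuclideanSpace ℝ (Fin d))} {ε R δ η m : ℝ} (hε : ε ≤ 1 / 2) (hR : 0 ≤ R)
    (hη : 0 < η)
    (hs : ∀ x, ‖x‖ = 1 → ∃ c ∈ s, ‖x - c‖ ≤ ε) (hTR : ∀ c ∈ s, ‖T c‖ ≤ R)
    (hm : ∀ c ∈ s, ((Finset.univ.filter fun k => |T c k| ≤ δ + η).card : ℝ) ≤ m)
    {x : EuclideanSpace ℝ (Fin d)} (hx : ‖x‖ = 1) :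
    ((Finset.univ.filter fun k => |T x k| < δ).card : ℝ) ≤ m + (2 * R * ε / η) ^ 2 := by
  have hε0 : 0 ≤ ε := by
    obtain ⟨c, -, hc⟩ := hs x hx
    exact (norm_nonneg _).trans hc
  have hT : ‖T‖ ≤ 2 * R := by
    have : ‖T‖ ≤ R + ‖T‖ * ε := by
      refine T.opNorm_le_of_unit_norm (by positivity) fun y hy => ?_
      obtain ⟨c, hc, hyc⟩ := hs y hy
      calc ‖T y‖ = ‖T c + T (y - c)‖ := by rw [← map_add]; congr 2; abel
        _ ≤ ‖T c‖ + ‖T (y - c)‖ := norm_add_le _ _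
        _ ≤ R + ‖T‖ * ε := add_le_add (hTR c hc)
            ((T.le_opNorm _).trans (by gcongr))
    nlinarith [norm_nonneg T]
  obtain ⟨c, hc, hxc⟩ := hs x hx
  set w := x - c with hw
  have hTw : ‖T w‖ ≤ 2 * R * ε := (T.le_opNorm _).trans (by gcongr)
  have hcard : ((Finset.univ.filter fun k => η < |T w k|).card : ℝ) ≤ (2 * R * ε / η) ^ 2 := by
    rw [div_pow, le_div_iff₀ (by positivity)]
    calc ((Finset.univ.filter fun k => η < |T w k|).card : ℝ) * η ^ 2
        = ∑ k ∈ Finset.univ.filter (fun k => η < |T w k|), η ^ 2 := by simp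
      _ ≤ ∑ k ∈ Finset.univ.filter (fun k => η < |T w k|), (T w k) ^ 2 := by
          refine Finset.sum_le_sum fun k hk => ?_
          rw [← sq_abs (T w k)]
          have := (Finset.mem_filter.1 hk).2
          gcongr
      _ ≤ ∑ k, (T w k) ^ 2 := Finset.sum_le_sum_of_subset_of_nonneg (Finset.filter_subset _ _)
          fun _ _ _ => sq_nonneg _
      _ = ‖T w‖ ^ 2 := (EuclideanSpace.real_norm_sq_eq _).symm
      _ ≤ (2 * R * ε) ^ 2 := by gcongr
  have hsub : (Finset.univ.filter fun k => |T x k| < δ) ⊆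
      (Finset.univ.filter fun k => |T c k| ≤ δ + η) ∪
        (Finset.univ.filter fun k => η < |T w k|) := by
    intro k hk
    have hk := (Finset.mem_filter.1 hk).2
    simp only [Finset.mem_union, Finset.mem_filter, Finset.mem_univ, true_and]
    by_contra! hcon
    have : T c k = T x k - T w k := by rw [hw, map_sub]; simp
    rw [this] at hcon
    linarith [abs_sub (T x k) (T w k), hcon.1, hcon.2]
  calc ((Finset.univ.filter fun k => |T x k| < δ).card : ℝ)
      ≤ ((Finset.univ.filter fun k => |T c k| ≤ δ + η).card : ℝ) +
        ((Finset.univ.filter fun k => η < |T w k|).card : ℝ) := by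
        exact_mod_cast (Finset.card_le_card hsub).trans (Finset.card_union_le _ _)
    _ ≤ _ := add_le_add (hm c hc) hcard

theorem exists_perm_sum_sortVec_sub_sq {n : ℕ} (u v : Fin n → ℝ) :
    ∃ σ : Equiv.Perm (Fin n),
      ∑ i, (sortVec u i - sortVec v i) ^ 2 = ∑ i, (u i - v (σ i)) ^ 2 := by
  refine ⟨(Tuple.sort u).symm.trans (Tuple.sort v), ?_⟩
  rw [← Equiv.sum_comp (Tuple.sort u) fun i =>
    (u i - v ((Tuple.sort u).symm.trans (Tuple.sort v) i)) ^ 2]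
  simp [sortVec]

/-- If, for every nonzero difference of a row of `X` and a row of `Y`, at most a fraction
`2 / (3 n²)` of the columns of `A` are almost orthogonal to it, then a third of the columns is
good for all differences at once. -/
theorem le_frob_betaEmb_sub {n d D : ℕ} (hn : 0 < n) (A : Matrix (Fin d) (Fin D) ℝ) {s : ℝ}
    (hs : 0 ≤ s)
    (hA : ∀ z : EuclideanSpace ℝ (Fin d), ‖z‖ = 1 →
      ((Finset.univ.filter fun k => |∑ l, z l * A l k| < s).card : ℝ) ≤
        2 / 3 * D / (n : ℝ) ^ 2)
    (X Y : Matrix (Fin n) (Fin d) ℝ) :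
    √(D / 3) * s * permDist X Y ≤ frob (betaEmb A X - betaEmb A Y) := by
  classical
  let z : Fin n → Fin n → EuclideanSpace ℝ (Fin d) := fun i j =>
    WithLp.toLp 2 fun l => X i l - Y j l
  let bad : Fin n → Fin n → Finset (Fin D) := fun i j =>
    Finset.univ.filter fun k => |∑ l, z i j l * A l k| < s * ‖z i j‖
  have hbad : ∀ i j, ((bad i j).card : ℝ) ≤ 2 / 3 * D / (n : ℝ) ^ 2 := by
    intro i j
    by_cases h0 : z i j = 0
    · have : bad i j = ∅ := by
        simp only [bad, h0, norm_zero, mul_zero, Finset.filter_eq_empty_iff]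
        intro k _
        exact not_lt.2 (abs_nonneg _)
      rw [this]
      simp only [Finset.card_empty, Nat.cast_zero]
      positivity
    · have hpos : 0 < ‖z i j‖ := norm_pos_iff.2 h0
      have h1 : ‖(‖z i j‖)⁻¹ • z i j‖ = 1 := by
        rw [norm_smul, norm_inv, norm_norm, inv_mul_cancel₀ hpos.ne']
      refine le_trans (le_of_eq ?_) (hA _ h1)
      congr 2
      refine Finset.filter_congr fun k _ => ?_
      have : ∑ l, ((‖z i j‖)⁻¹ • z i j) l * A l k = (‖z i j‖)⁻¹ * ∑ l, z i j l * A l k := by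
        rw [Finset.mul_sum]
        exact Finset.sum_congr rfl fun l _ => by simp [mul_assoc]
      rw [this, abs_mul, abs_inv, abs_norm, inv_mul_lt_iff₀ hpos, mul_comm s]
  let good : Finset (Fin D) :=
    Finset.univ \ (Finset.univ.biUnion fun p : Fin n × Fin n => bad p.1 p.2)
  have hgood : (D : ℝ) / 3 ≤ good.card := by
    have h1 : (((Finset.univ.biUnion fun p : Fin n × Fin n => bad p.1 p.2).card : ℕ) : ℝ) ≤
        2 / 3 * D := by
      calc (((Finset.univ.biUnion fun p : Fin n × Fin n => bad p.1 p.2).card : ℕ) : ℝ)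
          ≤ ∑ p : Fin n × Fin n, ((bad p.1 p.2).card : ℝ) := by
            exact_mod_cast Finset.card_biUnion_le
        _ ≤ ∑ p : Fin n × Fin n, 2 / 3 * D / (n : ℝ) ^ 2 := Finset.sum_le_sum fun p _ => hbad _ _
        _ = 2 / 3 * D := by
            simp only [Finset.sum_const, Finset.card_univ, Fintype.card_prod, Fintype.card_fin,
              nsmul_eq_mul, Nat.cast_mul]
            field_simp
    have h2 := Finset.card_sdiff_add_card_eq_card
      (Finset.subset_univ (Finset.univ.biUnion fun p : Fin n × Fin n => bad p.1 p.2))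
    rw [Finset.card_univ, Fintype.card_fin] at h2
    have h3 : (good.card : ℝ) + ((Finset.univ.biUnion fun p : Fin n × Fin n =>
      bad p.1 p.2).card : ℕ) = D := by exact_mod_cast h2
    linarith
  have hdist0 : 0 ≤ permDist X Y := Real.iInf_nonneg fun _ => Real.sqrt_nonneg _
  have hcol : ∀ k ∈ good, s ^ 2 * permDist X Y ^ 2 ≤
      ∑ i, (betaEmb A X i k - betaEmb A Y i k) ^ 2 := by
    intro k hk
    obtain ⟨σ, hσ⟩ := exists_perm_sum_sortVec_sub_sq (X.mulVec fun l => A l k)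
      (Y.mulVec fun l => A l k)
    have hle : permDist X Y ≤ frob (X - Y.submatrix σ id) :=
      ciInf_le (Set.finite_range _).bddBelow σ
    have hsq : frob (X - Y.submatrix σ id) ^ 2 = ∑ i, ‖z i (σ i)‖ ^ 2 := by
      rw [frob, Real.sq_sqrt (by positivity)]
      simp [z, EuclideanSpace.real_norm_sq_eq]
    calc s ^ 2 * permDist X Y ^ 2 ≤ s ^ 2 * frob (X - Y.submatrix σ id) ^ 2 := by gcongr
      _ = ∑ i, (s * ‖z i (σ i)‖) ^ 2 := by rw [hsq, Finset.mul_sum]; simp only [mul_pow]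
      _ ≤ ∑ i, (X.mulVec (fun l => A l k) i - Y.mulVec (fun l => A l k) (σ i)) ^ 2 := by
          refine Finset.sum_le_sum fun i _ => ?_
          have h1 : k ∉ bad i (σ i) := fun h => (Finset.mem_sdiff.1 hk).2
            (Finset.mem_biUnion.2 ⟨(i, σ i), Finset.mem_univ _, h⟩)
          have h2 : s * ‖z i (σ i)‖ ≤ |∑ l, z i (σ i) l * A l k| := by
            simpa [bad] using h1
          have h3 : X.mulVec (fun l => A l k) i - Y.mulVec (fun l => A l k) (σ i) =
              ∑ l, z i (σ i) l * A l k := by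
            simp [z, Matrix.mulVec, dotProduct, sub_mul]
          rw [h3, ← sq_abs (∑ l, z i (σ i) l * A l k)]
          gcongr
      _ = _ := hσ.symm
  refine Real.le_sqrt_of_sq_le ?_
  rw [Finset.sum_comm, mul_pow, mul_pow, Real.sq_sqrt (by positivity)]
  calc (D : ℝ) / 3 * s ^ 2 * permDist X Y ^ 2 ≤ good.card * (s ^ 2 * permDist X Y ^ 2) := by
        rw [mul_assoc]; gcongr
    _ = ∑ k ∈ good, s ^ 2 * permDist X Y ^ 2 := by simp
    _ ≤ ∑ k ∈ good, ∑ i, (betaEmb A X i k - betaEmb A Y i k) ^ 2 := Finset.sum_le_sum hcol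
    _ ≤ ∑ k, ∑ i, (betaEmb A X i k - betaEmb A Y i k) ^ 2 :=
        Finset.sum_le_sum_of_subset_of_nonneg (Finset.subset_univ _)
          fun _ _ _ => Finset.sum_nonneg fun _ _ => sq_nonneg _

theorem union_bound_le {N D : ℝ} (d : ℕ) (hN : 1 ≤ N) (hd : 1 ≤ d)
    (hD : 10000 * N ^ 2 * d ≤ D) :
    (1 + 2 / (1 / (1000 * N ^ 2))) ^ d *
      (Real.exp (1 / (4 * N) * D - 3 / 5 * D / N * Real.log 2) + Real.exp (-D)) ≤
      Real.exp (-(8 / 81) * D / N ^ 2) := by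
  have hN0 : 0 < N := by linarith
  have hd' : (1 : ℝ) ≤ d := by exact_mod_cast hd
  set x := D / N with hx
  have hDx : D = x * N := by rw [hx]; field_simp
  have hxd : 10000 * N * d ≤ x := by
    rw [hx, le_div_iff₀ hN0]
    linarith
  have hNd : 1 ≤ N * d := one_le_mul_of_one_le_of_one_le hN hd'
  have hx0 : 10000 ≤ x := by linarith
  have h1 : (1 + 2 / (1 / (1000 * N ^ 2))) ^ d ≤ Real.exp (x * (9 / 1000)) := by
    have h : 1 + 2 / (1 / (1000 * N ^ 2)) ≤ Real.exp (90 * N) := by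
      calc 1 + 2 / (1 / (1000 * N ^ 2)) = 1 + 2000 * N ^ 2 := by field_simp; ring
        _ ≤ (45 * N + 1) ^ 2 := by nlinarith
        _ ≤ Real.exp (45 * N) ^ 2 := by gcongr; exact Real.add_one_le_exp _
        _ = Real.exp (90 * N) := by rw [← Real.exp_nat_mul]; congr 1; push_cast; ring
    calc (1 + 2 / (1 / (1000 * N ^ 2))) ^ d ≤ Real.exp (90 * N) ^ d := by gcongr
      _ = Real.exp (d * (90 * N)) := by rw [← Real.exp_nat_mul]
      _ ≤ _ := Real.exp_le_exp.2 (by linarith)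
  have h2 : Real.exp (1 / (4 * N) * D - 3 / 5 * D / N * Real.log 2) ≤
      Real.exp (x * (-165 / 1000)) := by
    gcongr
    have : 1 / (4 * N) * D - 3 / 5 * D / N * Real.log 2 = x * (1 / 4 - 3 / 5 * Real.log 2) := by
      rw [hx]; field_simp
    rw [this]
    gcongr
    linarith [Real.log_two_gt_d9]
  have h3 : Real.exp (-D) ≤ Real.exp (x * (-165 / 1000)) := by
    gcongr
    nlinarith
  have h4 : (2 : ℝ) ≤ Real.exp 1 := by linarith [Real.add_one_le_exp 1]
  calc _ ≤ Real.exp (x * (9 / 1000)) * (Real.exp 1 * Real.exp (x * (-165 / 1000))) := by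
        gcongr
        nlinarith [Real.exp_pos (x * (-165 / 1000))]
    _ = Real.exp (x * (-156 / 1000) + 1) := by
        rw [← Real.exp_add, ← Real.exp_add]; congr 1; ring
    _ ≤ Real.exp (-(8 / 81) * D / N ^ 2) := by
        gcongr
        have h5 : -(8 / 81) * D / N ^ 2 = -(8 / 81) * (x / N) := by rw [hx]; field_simp
        have h6 : x / N ≤ x := div_le_self (by linarith) hN
        rw [h5]
        linarith

/-- With high probability, every direction is almost orthogonal to few columns only. -/
theorem measure_exists_card_gt_le {d D : ℕ} {N : ℝ} (hN : 1 ≤ N) (hd : 1 ≤ d)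
    (hD : 10000 * N ^ 2 * d ≤ D) :
    gaussianMatrix d D {A | ¬ ∀ z : EuclideanSpace ℝ (Fin d), ‖z‖ = 1 →
      ((Finset.univ.filter fun k => |∑ l, z l * A l k| < √(2 * Real.pi) / (9 * N)).card : ℝ) ≤
        2 / 3 * D / N} ≤
      ENNReal.ofReal (Real.exp (-(8 / 81) * D / N ^ 2)) := by
  have hN0 : 0 < N := by linarith
  have hpi : 0 < √(2 * Real.pi) := by positivity
  set δ := √(2 * Real.pi) / (9 * N) with hδ
  have hδ0 : 0 < δ := by positivity
  obtain ⟨S, hS1, hScard, hSnet⟩ := exists_net_unit_sphere (d := d)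
    (ε := 1 / (1000 * N ^ 2)) (by positivity)
  let few : EuclideanSpace ℝ (Fin d) → Set (Fin d → Fin D → ℝ) := fun z =>
    {A | 3 / 5 * D / N ≤ (Finset.univ.filter fun k => |∑ l, z l * A l k| ≤ δ + δ / 8).card}
  let large : EuclideanSpace ℝ (Fin d) → Set (Fin d → Fin D → ℝ) := fun z =>
    {A | 8 * (D : ℝ) ≤ ∑ k, (∑ l, z l * A l k) ^ 2}
  have hsub : {A : Fin d → Fin D → ℝ | ¬ ∀ z : EuclideanSpace ℝ (Fin d), ‖z‖ = 1 →
      ((Finset.univ.filter fun k => |∑ l, z l * A l k| < δ).card : ℝ) ≤ 2 / 3 * D / N} ⊆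
      ⋃ c ∈ S, few c ∪ large c := by
    intro A hA
    by_contra hcon
    simp only [Set.mem_iUnion, Set.mem_union, not_exists, not_or] at hcon
    refine hA fun z hz => ?_
    let T : EuclideanSpace ℝ (Fin d) →L[ℝ] EuclideanSpace ℝ (Fin D) :=
      (Matrix.toEuclideanLin (Matrix.of A)ᵀ).toContinuousLinearMap
    have hT : ∀ z k, T z k = ∑ l, z l * A l k := by
      intro z k
      simp [T, Matrix.toEuclideanLin, Matrix.mulVec, dotProduct, mul_comm]
    have h := card_filter_le_of_net T (s := S) (R := √(8 * D)) (δ := δ) (η := δ / 8)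
      (m := 3 / 5 * D / N) (ε := 1 / (1000 * N ^ 2)) ?_ (Real.sqrt_nonneg _) (by positivity)
      hSnet ?_ ?_ hz
    · simp only [hT] at h
      refine h.trans ?_
      have h1 : (2 * √(8 * D) * (1 / (1000 * N ^ 2)) / (δ / 8)) ^ 2 =
          2048 * 81 / (10 ^ 6 * (2 * Real.pi)) * D / N ^ 2 := by
        rw [hδ]
        have e1 : √(8 * (D : ℝ)) ^ 2 = 8 * D := Real.sq_sqrt (by positivity)
        have e2 : √(2 * Real.pi) ^ 2 = 2 * Real.pi := Real.sq_sqrt (by positivity)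
        simp only [div_pow, mul_pow, e1, e2]
        field_simp
        ring
      have h2 : 2048 * 81 / (10 ^ 6 * (2 * Real.pi)) ≤ 1 / 15 := by
        rw [div_le_div_iff₀ (by positivity) (by norm_num)]
        linarith [Real.pi_gt_three]
      have h3 : 2048 * 81 / (10 ^ 6 * (2 * Real.pi)) * D / N ^ 2 ≤ 1 / 15 * D / N := by
        gcongr
        nlinarith
      calc _ ≤ 3 / 5 * D / N + 1 / 15 * D / N := by rw [h1]; gcongr
        _ = _ := by ring
    · rw [div_le_div_iff₀ (by positivity) (by norm_num)]
      nlinarith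
    · intro c hc
      refine Real.le_sqrt_of_sq_le ?_
      rw [EuclideanSpace.real_norm_sq_eq]
      simp only [hT]
      exact (not_le.1 (hcon c hc).2).le
    · intro c hc
      simp only [hT]
      exact (not_le.1 (hcon c hc).1).le
  have hp : 2 * (δ + δ / 8) / √(2 * Real.pi) ≤ 1 / (4 * N) := by
    rw [hδ]
    refine le_of_eq ?_
    field_simp
    norm_num
  calc _ ≤ gaussianMatrix d D (⋃ c ∈ S, few c ∪ large c) := measure_mono hsub
    _ ≤ ∑ c ∈ S, gaussianMatrix d D (few c ∪ large c) := measure_biUnion_finset_le _ _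
    _ ≤ ∑ c ∈ S, ENNReal.ofReal
        (Real.exp (1 / (4 * N) * D - 3 / 5 * D / N * Real.log 2) + Real.exp (-D)) := by
        refine Finset.sum_le_sum fun c hc => (measure_union_le _ _).trans ?_
        rw [ENNReal.ofReal_add (Real.exp_pos _).le (Real.exp_pos _).le]
        exact add_le_add
          (measure_card_abs_le_gaussianMatrix c (hS1 c hc) (by positivity) hp _)
          (measure_sum_sq_ge_gaussianMatrix c (hS1 c hc))
    _ = ENNReal.ofReal (S.card *
        (Real.exp (1 / (4 * N) * D - 3 / 5 * D / N * Real.log 2) + Real.exp (-D))) := by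
        rw [Finset.sum_const, nsmul_eq_mul, ENNReal.ofReal_mul (by positivity),
          ENNReal.ofReal_natCast]
    _ ≤ _ := by
        refine ENNReal.ofReal_le_ofReal (le_trans ?_ (union_bound_le d hN hd hD))
        gcongr

/-- There is an absolute constant `C > 0` such that, for `D ≥ C·n⁴·d`, a `d × D` matrix
with i.i.d. standard Gaussian entries satisfies, with probability at least
`1 - exp(-(8/81)·D/n⁴)`, the lower Lipschitz bound
`‖β_A(X) - β_A(Y)‖_F ≥ (√(2π)/(9√3))·(√D/n²)·dist(X,Y)` for all `X, Y`. -/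
theorem stmt11 : ∃ C : ℝ, 0 < C ∧ ∀ (d n D : ℕ), (D : ℝ) ≥ C * n ^ 4 * d →
    (Measure.pi fun _ : Fin d => Measure.pi fun _ : Fin D => ProbabilityTheory.gaussianReal 0 1)
      {A : Fin d → Fin D → ℝ | ∀ X Y : Matrix (Fin n) (Fin d) ℝ,
        frob (betaEmb (Matrix.of A) X - betaEmb (Matrix.of A) Y) ≥
          Real.sqrt (2 * Real.pi) / (9 * Real.sqrt 3) * (Real.sqrt D / (n : ℝ) ^ 2) *
            permDist X Y} ≥
      ENNReal.ofReal (1 - Real.exp (-(8 / 81) * D / (n : ℝ) ^ 4)) := by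
  refine ⟨10000, by norm_num, fun d n D hD => ?_⟩
  rcases Nat.eq_zero_or_pos n with rfl | hn
  · simp
  rcases Nat.eq_zero_or_pos d with rfl | hd
  · have h0 : ∀ X Y : Matrix (Fin n) (Fin 0) ℝ, permDist X Y = 0 := fun X Y => by
      simp [permDist, frob]
    simp only [h0, mul_zero, ge_iff_le]
    refine le_trans (ENNReal.ofReal_le_one.2 ?_) (le_of_eq ?_)
    · linarith [Real.exp_pos (-(8 / 81) * D / (n : ℝ) ^ 4)]
    · rw [← measure_univ (μ := gaussianMatrix 0 D)]
      congr 1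
      ext A
      simp [frob, Real.sqrt_nonneg]
  have hn1 : (1 : ℝ) ≤ n := by exact_mod_cast hn
  have hbad := measure_exists_card_gt_le (d := d) (D := D) (N := (n : ℝ) ^ 2)
    (one_le_pow₀ hn1) hd (by rw [← pow_mul]; exact hD)
  rw [← pow_mul] at hbad
  set bad := {A : Fin d → Fin D → ℝ | ¬ ∀ z : EuclideanSpace ℝ (Fin d), ‖z‖ = 1 →
      ((Finset.univ.filter fun k =>
        |∑ l, z l * A l k| < √(2 * Real.pi) / (9 * (n : ℝ) ^ 2)).card : ℝ) ≤
        2 / 3 * D / (n : ℝ) ^ 2} with hbad_def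
  rw [ge_iff_le, ENNReal.ofReal_sub _ (Real.exp_pos _).le, ENNReal.ofReal_one, tsub_le_iff_right]
  refine le_trans ?_ (add_le_add_right hbad _)
  refine le_trans ?_ (measure_union_le _ _)
  rw [← measure_univ (μ := gaussianMatrix d D)]
  refine measure_mono fun A _ => ?_
  by_cases hA : A ∈ bad
  · exact Or.inr hA
  refine Or.inl fun X Y => ?_
  have h := le_frob_betaEmb_sub hn (Matrix.of A) (s := √(2 * Real.pi) / (9 * (n : ℝ) ^ 2))
    (by positivity) (not_not.1 hA) X Y
  refine le_trans (le_of_eq ?_) h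
  rw [Real.sqrt_div (Nat.cast_nonneg D)]
  congr 1
  field_simp
end
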